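/- arXiv:1803.11432 — 2 statements merged into one kernel-verified Lean document; each statement's English description precedes it below -/
import Mathlib

section
/- Let T > 0 and let V, U : ℝ × ℝ^p → ℝ be bounded and uniformly continuous. For ε, α, η > 0 define M_{ε,α,η} := sup over [0,T] × [0,T] × ℝ^p × ℝ^p of Φ_{ε,α,η}(t,s,x,y) := V(t,x) − U(s,y) − (|t−s|² + ‖x−y‖²)/(2ε) − (α/2)(‖x‖² + ‖y‖²) + η t, and let M := sup_{(t,x) ∈ [0,T] × ℝ^p} ( V(t,x) − U(t,x) ). Then for all sequences ε_n ↓ 0, α_n ↓ 0, η_n ↓ 0 of positive reals, M_{ε_n,α_n,η_n} → M as n → ∞. -/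
open Set Filter

/-- The penalized function of the doubling-of-variables argument in the proof of the
comparison principle (Theorem 5.5). -/
noncomputable def penalized {p : ℕ} (V U : ℝ → EuclideanSpace ℝ (Fin p) → ℝ)
    (ε α η : ℝ) (t s : ℝ) (x y : EuclideanSpace ℝ (Fin p)) : ℝ :=
  V t x - U s y - (|t - s| ^ 2 + ‖x - y‖ ^ 2) / (2 * ε)
    - (α / 2) * (‖x‖ ^ 2 + ‖y‖ ^ 2) + η * t

/-- `M_{ε,α,η}`: the supremum of the penalized function over
`[0,T] × [0,T] × ℝ^p × ℝ^p`. -/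
noncomputable def penalizedSup {p : ℕ} (T : ℝ)
    (V U : ℝ → EuclideanSpace ℝ (Fin p) → ℝ) (ε α η : ℝ) : ℝ :=
  sSup {m : ℝ | ∃ t ∈ Icc (0 : ℝ) T, ∃ s ∈ Icc (0 : ℝ) T,
    ∃ x y : EuclideanSpace ℝ (Fin p), m = penalized V U ε α η t s x y}

/-- The penalized function with nonnegative parameters is bounded by the bounds of its two terms
plus the time penalty. -/
theorem penalized_le {p : ℕ} {V U : ℝ → EuclideanSpace ℝ (Fin p) → ℝ} {A B T ε α η t s : ℝ}
    (hV : ∀ t x, |V t x| ≤ A) (hU : ∀ t x, |U t x| ≤ B) (hα : 0 ≤ α) (hη : 0 ≤ η)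
    (ht : t ≤ T) (x y : EuclideanSpace ℝ (Fin p)) :
    penalized V U ε α η t s x y ≤
      A + B - (|t - s| ^ 2 + ‖x - y‖ ^ 2) / (2 * ε) + η * T := by
  have h1 := (abs_le.1 (hV t x)).2
  have h2 := (abs_le.1 (hU s y)).1
  have h3 : 0 ≤ (α / 2) * (‖x‖ ^ 2 + ‖y‖ ^ 2) := by positivity
  have h4 : η * t ≤ η * T := mul_le_mul_of_nonneg_left ht hη
  unfold penalized
  linarith

/-- The values whose supremum is `penalizedSup` are bounded above. -/
theorem bddAbove_penalized {p : ℕ} {V U : ℝ → EuclideanSpace ℝ (Fin p) → ℝ} {A B T ε α η : ℝ}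
    (hV : ∀ t x, |V t x| ≤ A) (hU : ∀ t x, |U t x| ≤ B)
    (hε : 0 ≤ ε) (hα : 0 ≤ α) (hη : 0 ≤ η) :
    BddAbove {m : ℝ | ∃ t ∈ Icc (0 : ℝ) T, ∃ s ∈ Icc (0 : ℝ) T,
      ∃ x y : EuclideanSpace ℝ (Fin p), m = penalized V U ε α η t s x y} := by
  refine ⟨A + B + η * T, ?_⟩
  rintro m ⟨t, ht, s, -, x, y, rfl⟩
  have h1 := penalized_le (ε := ε) (s := s) hV hU hα hη ht.2 x y
  have h2 : 0 ≤ (|t - s| ^ 2 + ‖x - y‖ ^ 2) / (2 * ε) := by positivity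
  linarith

/-- Convergence of the penalized suprema: for bounded uniformly continuous `V`, `U`,
as the parameters `ε, α, η` decrease to `0`, `M_{ε,α,η}` converges to
`M = sup_{[0,T] × ℝ^p} (V − U)`. -/
theorem penalizedSup_tendsto {p : ℕ} (T : ℝ) (hT : 0 < T)
    (V U : ℝ → EuclideanSpace ℝ (Fin p) → ℝ)
    (hVbdd : ∃ C : ℝ, ∀ t x, |V t x| ≤ C) (hUbdd : ∃ C : ℝ, ∀ t x, |U t x| ≤ C)
    (hVuc : UniformContinuous fun q : ℝ × EuclideanSpace ℝ (Fin p) => V q.1 q.2)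
    (hUuc : UniformContinuous fun q : ℝ × EuclideanSpace ℝ (Fin p) => U q.1 q.2)
    (ε α η : ℕ → ℝ)
    (hε : ∀ n, 0 < ε n) (hεa : Antitone ε) (hε0 : Tendsto ε atTop (nhds 0))
    (hα : ∀ n, 0 < α n) (hαa : Antitone α) (hα0 : Tendsto α atTop (nhds 0))
    (hη : ∀ n, 0 < η n) (hηa : Antitone η) (hη0 : Tendsto η atTop (nhds 0)) :
    Tendsto (fun n => penalizedSup T V U (ε n) (α n) (η n)) atTop
      (nhds (sSup {m : ℝ | ∃ t ∈ Icc (0 : ℝ) T,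
        ∃ x : EuclideanSpace ℝ (Fin p), m = V t x - U t x})) := by
  obtain ⟨A, hA⟩ := hVbdd
  obtain ⟨B, hB⟩ := hUbdd
  set S : Set ℝ := {m : ℝ | ∃ t ∈ Icc (0 : ℝ) T,
    ∃ x : EuclideanSpace ℝ (Fin p), m = V t x - U t x} with hS
  have h0 : (0 : ℝ) ∈ Icc (0 : ℝ) T := ⟨le_rfl, hT.le⟩
  have hSne : S.Nonempty := ⟨_, 0, h0, 0, rfl⟩
  have hSbdd : BddAbove S := by
    refine ⟨A + B, ?_⟩
    rintro m ⟨t, -, x, rfl⟩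
    linarith [(abs_le.1 (hA t x)).2, (abs_le.1 (hB t x)).1]
  have hSlow : -(A + B) ≤ sSup S := by
    refine le_trans ?_ (le_csSup hSbdd ⟨0, h0, 0, rfl⟩)
    linarith [(abs_le.1 (hA 0 0)).1, (abs_le.1 (hB 0 0)).2]
  refine tendsto_order.2 ⟨fun a ha => ?_, fun a ha => ?_⟩
  · obtain ⟨_, ⟨t, ht, x, rfl⟩, htx⟩ := exists_lt_of_lt_csSup hSne ha
    have hlim : Tendsto (fun n => V t x - U t x - α n * ‖x‖ ^ 2) atTop (nhds (V t x - U t x)) := by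
      simpa using (hα0.mul_const (‖x‖ ^ 2)).const_sub (V t x - U t x)
    filter_upwards [hlim.eventually_const_lt htx] with n hn
    refine hn.trans_le (le_trans ?_ (le_csSup
      (bddAbove_penalized hA hB (hε n).le (hα n).le (hη n).le) ⟨t, ht, t, ht, x, x, rfl⟩))
    have h1 : 0 ≤ η n * t := mul_nonneg (hη n).le ht.1
    simp only [penalized, sub_self, abs_zero, norm_zero]
    norm_num
    linarith
  · set e := a - sSup S with he
    have hepos : 0 < e := sub_pos.2 ha
    obtain ⟨r, hr, hrU⟩ := Metric.uniformContinuous_iff.1 hUuc (e / 4) (by linarith)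
    have hη1 : ∀ᶠ n in atTop, η n * T < e / 4 := by
      have hlim : Tendsto (fun n => η n * T) atTop (nhds 0) := by simpa using hη0.mul_const T
      exact hlim.eventually_lt_const (by linarith)
    have hε1 : ∀ᶠ n in atTop, 2 * (A + B) * (2 * ε n) < r ^ 2 := by
      have hlim : Tendsto (fun n => 2 * (A + B) * (2 * ε n)) atTop (nhds 0) := by
        simpa using (hε0.const_mul 2).const_mul (2 * (A + B))
      exact hlim.eventually_lt_const (by positivity)
    filter_upwards [hη1, hε1] with n hηn hεn
    have hε2 : 0 < 2 * ε n := by linarith [hε n]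
    refine lt_of_le_of_lt (b := sSup S + e / 2) (csSup_le ⟨_, 0, h0, 0, h0, 0, 0, rfl⟩ ?_)
      (by linarith)
    rintro m ⟨t, ht, s, hs, x, y, rfl⟩
    by_cases hd : dist (t, x) (s, y) < r
    · have h1 := (abs_lt.1 (hrU hd)).2
      have h2 : V t x - U t x ≤ sSup S := le_csSup hSbdd ⟨t, ht, x, rfl⟩
      have h3 : 0 ≤ (α n / 2) * (‖x‖ ^ 2 + ‖y‖ ^ 2) := by have := hα n; positivity
      have h4 : η n * t ≤ η n * T := mul_le_mul_of_nonneg_left ht.2 (hη n).le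
      have h5 : 0 ≤ (|t - s| ^ 2 + ‖x - y‖ ^ 2) / (2 * ε n) := by positivity
      simp only [penalized] at h1 ⊢
      linarith
    · have h1 : r ^ 2 ≤ |t - s| ^ 2 + ‖x - y‖ ^ 2 := by
        rw [not_lt, Prod.dist_eq, le_max_iff, Real.dist_eq, dist_eq_norm] at hd
        rcases hd with hd | hd
        · linarith [pow_le_pow_left₀ hr.le hd 2, sq_nonneg ‖x - y‖]
        · linarith [pow_le_pow_left₀ hr.le hd 2, sq_nonneg |t - s|]
      have h2 : 2 * (A + B) ≤ (|t - s| ^ 2 + ‖x - y‖ ^ 2) / (2 * ε n) :=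
        (le_div_iff₀ hε2).2 (hεn.le.trans h1)
      linarith [penalized_le (ε := ε n) (s := s) hA hB (hα n).le (hη n).le ht.2 x y]
end

section
/- Let T > 0, let V, U : ℝ × ℝ^p → ℝ be bounded and uniformly continuous, and fix α, η > 0. For each ε > 0 define Φ_{ε,α,η}(t,s,x,y) := V(t,x) − U(s,y) − (|t−s|² + ‖x−y‖²)/(2ε) − (α/2)(‖x‖² + ‖y‖²) + η t on [0,T] × [0,T] × ℝ^p × ℝ^p, and let (t̄_ε, s̄_ε, x̄_ε, ȳ_ε) be any maximizer of Φ_{ε,α,η}. Then the coupling penalty at the maximizers vanishes as ε ↓ 0: (|t̄_ε − s̄_ε|² + ‖x̄_ε − ȳ_ε‖²)/(2ε) → 0 as ε → 0⁺; in particular |t̄_ε − s̄_ε| → 0 and ‖x̄_ε − ȳ_ε‖ → 0. -/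
open Set Filter

/-- Comparing a maximizer with the two diagonal points over it bounds twice the coupling penalty
by the oscillation of `U`, `V` and the linear term between the two copies of the variables. -/
lemma penalized_coupling_le {p : ℕ} {V U : ℝ → EuclideanSpace ℝ (Fin p) → ℝ}
    {ε α η t s : ℝ} {x y : EuclideanSpace ℝ (Fin p)}
    (hx : penalized V U ε α η t t x x ≤ penalized V U ε α η t s x y)
    (hy : penalized V U ε α η s s y y ≤ penalized V U ε α η t s x y) :
    2 * ((|t - s| ^ 2 + ‖x - y‖ ^ 2) / (2 * ε)) ≤
      |U t x - U s y| + |V t x - V s y| + η * (t - s) := by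
  have hU := le_abs_self (U t x - U s y)
  have hV := le_abs_self (V t x - V s y)
  simp only [penalized, sub_self, abs_zero, norm_zero, ne_eq, OfNat.ofNat_ne_zero,
    not_false_eq_true, zero_pow, add_zero, zero_div, sub_zero] at hx hy
  linarith

/-- A uniformly continuous function of two variables has vanishing increments along families
whose two components merge. -/
lemma UniformContinuous.tendsto_abs_sub_zero {ι E : Type*} [SeminormedAddCommGroup E]
    {l : Filter ι} {W : ℝ → E → ℝ} (hW : UniformContinuous fun q : ℝ × E => W q.1 q.2)
    {t s : ι → ℝ} {x y : ι → E} (hts : Tendsto (fun i => |t i - s i|) l (nhds 0))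
    (hxy : Tendsto (fun i => ‖x i - y i‖) l (nhds 0)) :
    Tendsto (fun i => |W (t i) (x i) - W (s i) (y i)|) l (nhds 0) := by
  have hpair : Tendsto (fun i => ((t i, x i), (s i, y i))) l (uniformity (ℝ × E)) := by
    rw [tendsto_uniformity_iff_dist_tendsto_zero]
    simpa [Prod.dist_eq, Real.dist_eq, dist_eq_norm] using hts.max hxy
  have h := tendsto_uniformity_iff_dist_tendsto_zero.1 (Tendsto.comp hW hpair)
  simpa only [Real.dist_eq, Function.comp_apply] using h

/-- Vanishing of the coupling penalty: for bounded uniformly continuous `V`, `U`, fixed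
`α, η > 0`, and any family `(t̄_ε, s̄_ε, x̄_ε, ȳ_ε)` of maximizers of the penalized
function over `[0,T] × [0,T] × ℝ^p × ℝ^p`, the coupling penalty
`(|t̄_ε − s̄_ε|² + ‖x̄_ε − ȳ_ε‖²)/(2ε)` tends to `0` as `ε ↓ 0`; in particular the
maximizing points in the two copies of the variables merge. -/
theorem penalized_coupling_vanishes {p : ℕ} (T : ℝ) (hT : 0 < T)
    (V U : ℝ → EuclideanSpace ℝ (Fin p) → ℝ)
    (hVbdd : ∃ C : ℝ, ∀ t x, |V t x| ≤ C) (hUbdd : ∃ C : ℝ, ∀ t x, |U t x| ≤ C)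
    (hVuc : UniformContinuous fun q : ℝ × EuclideanSpace ℝ (Fin p) => V q.1 q.2)
    (hUuc : UniformContinuous fun q : ℝ × EuclideanSpace ℝ (Fin p) => U q.1 q.2)
    (α η : ℝ) (hα : 0 < α) (hη : 0 < η)
    (tb sb : ℝ → ℝ) (xb yb : ℝ → EuclideanSpace ℝ (Fin p))
    (hmem : ∀ ε > (0 : ℝ), tb ε ∈ Icc (0 : ℝ) T ∧ sb ε ∈ Icc (0 : ℝ) T)
    (hmax : ∀ ε > (0 : ℝ), ∀ t ∈ Icc (0 : ℝ) T, ∀ s ∈ Icc (0 : ℝ) T,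
      ∀ x y : EuclideanSpace ℝ (Fin p),
        penalized V U ε α η t s x y ≤ penalized V U ε α η (tb ε) (sb ε) (xb ε) (yb ε)) :
    Tendsto (fun ε => (|tb ε - sb ε| ^ 2 + ‖xb ε - yb ε‖ ^ 2) / (2 * ε))
        (nhdsWithin 0 (Ioi 0)) (nhds 0) ∧
      Tendsto (fun ε => |tb ε - sb ε|) (nhdsWithin 0 (Ioi 0)) (nhds 0) ∧
      Tendsto (fun ε => ‖xb ε - yb ε‖) (nhdsWithin 0 (Ioi 0)) (nhds 0) := by
  obtain ⟨C, hC⟩ := hVbdd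
  obtain ⟨D, hD⟩ := hUbdd
  have hle : ∀ ε > (0 : ℝ), 2 * ((|tb ε - sb ε| ^ 2 + ‖xb ε - yb ε‖ ^ 2) / (2 * ε)) ≤
      |U (tb ε) (xb ε) - U (sb ε) (yb ε)| + |V (tb ε) (xb ε) - V (sb ε) (yb ε)|
        + η * (tb ε - sb ε) := fun ε hε =>
    penalized_coupling_le (hmax ε hε _ (hmem ε hε).1 _ (hmem ε hε).1 _ _)
      (hmax ε hε _ (hmem ε hε).2 _ (hmem ε hε).2 _ _)
  have hsum : ∀ ε > (0 : ℝ), |tb ε - sb ε| ^ 2 + ‖xb ε - yb ε‖ ^ 2 ≤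
      (2 * D + 2 * C + η * T) * ε := by
    intro ε hε
    have hU := (abs_sub _ _).trans (add_le_add (hD (tb ε) (xb ε)) (hD (sb ε) (yb ε)))
    have hV := (abs_sub _ _).trans (add_le_add (hC (tb ε) (xb ε)) (hC (sb ε) (yb ε)))
    have hts : η * (tb ε - sb ε) ≤ η * T :=
      mul_le_mul_of_nonneg_left (by linarith [(hmem ε hε).1.2, (hmem ε hε).2.1]) hη.le
    rw [← div_le_iff₀ hε]
    calc (|tb ε - sb ε| ^ 2 + ‖xb ε - yb ε‖ ^ 2) / ε
        = 2 * ((|tb ε - sb ε| ^ 2 + ‖xb ε - yb ε‖ ^ 2) / (2 * ε)) := by field_simp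
      _ ≤ 2 * D + 2 * C + η * T := by linarith [hle ε hε]
  have hsqrt : Tendsto (fun ε : ℝ => √((2 * D + 2 * C + η * T) * ε))
      (nhdsWithin 0 (Ioi 0)) (nhds 0) := by
    have hcont : Continuous fun ε : ℝ => √((2 * D + 2 * C + η * T) * ε) := by fun_prop
    simpa using (hcont.tendsto 0).mono_left nhdsWithin_le_nhds
  have hts : Tendsto (fun ε => |tb ε - sb ε|) (nhdsWithin 0 (Ioi 0)) (nhds 0) := by
    refine squeeze_zero' (.of_forall fun ε => abs_nonneg _) ?_ hsqrt
    filter_upwards [self_mem_nhdsWithin] with ε hε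
    exact Real.le_sqrt_of_sq_le (by linarith [hsum ε hε, sq_nonneg ‖xb ε - yb ε‖])
  have hxy : Tendsto (fun ε => ‖xb ε - yb ε‖) (nhdsWithin 0 (Ioi 0)) (nhds 0) := by
    refine squeeze_zero' (.of_forall fun ε => norm_nonneg _) ?_ hsqrt
    filter_upwards [self_mem_nhdsWithin] with ε hε
    exact Real.le_sqrt_of_sq_le (by linarith [hsum ε hε, sq_nonneg |tb ε - sb ε|])
  refine ⟨?_, hts, hxy⟩
  have hbound := ((hUuc.tendsto_abs_sub_zero hts hxy).add
    (hVuc.tendsto_abs_sub_zero hts hxy)).add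
      ((tendsto_zero_iff_abs_tendsto_zero _).2 hts |>.const_mul η)
  have hhalf := hbound.div_const 2
  simp only [mul_zero, add_zero, zero_div] at hhalf
  refine squeeze_zero' ?_ ?_ hhalf
  · filter_upwards [self_mem_nhdsWithin] with ε hε
    have hε' : (0 : ℝ) < ε := hε
    positivity
  · filter_upwards [self_mem_nhdsWithin] with ε hε
    linarith [hle ε hε]
end
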